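/- (Proposition A.2.1) Let r*_{α,q} := E[‖(1/n)XᵀW‖_q] + σ N_q(X) √((2/n) log(1/α)) for α ∈ (0,1), and fix q, q̃ ∈ [1,∞]. Then with probability at least 1 − α over W, every pair (θ̂, μ̂) ∈ ℝ^p × ℝ^L that is optimal for the program 'minimize ‖μ‖_{q̃} over (θ,μ) subject to ‖(1/n)∑_{i=1}^n X_i (Y_i − g(V_i,θ)) − μ‖_q ≤ r*_{α,q} and h(θ) ∈ Ω' satisfies both ‖(1/n)∑_{i=1}^n X_i ( g(V_i,θ*) − g(V_i,θ̂) )‖_{q̃} ≥ ‖μ̂‖_{q̃} and ‖(1/n)∑_{i=1}^n X_i ( g(V_i,θ*) − g(V_i,θ̂) ) − μ̂‖_q ≤ 2 r*_{α,q}. -/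

import Mathlib

open MeasureTheory ProbabilityTheory
open scoped ENNReal NNReal

noncomputable def lqNorm (q : ℝ≥0∞) {L : ℕ} (v : Fin L → ℝ) : ℝ :=
  (eLpNorm v q Measure.count).toReal

noncomputable def Nq (q : ℝ≥0∞) {n L : ℕ} (X : Fin n → Fin L → ℝ) : ℝ :=
  lqNorm q (fun j => Real.sqrt ((1 / (n : ℝ)) * ∑ i, (X i j) ^ 2))

noncomputable def gaussianVec (n : ℕ) (σ : ℝ) : Measure (Fin n → ℝ) :=
  Measure.pi (fun _ => gaussianReal 0 ⟨σ ^ 2, sq_nonneg σ⟩)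
/-- Feasibility for the alternative program (p1-1), with vector-valued slack `μ ∈ ℝ^L`. -/
def FeasibleP1 {n L k p m : ℕ} (X : Fin n → Fin L → ℝ)
    (g : (Fin k → ℝ) → (Fin p → ℝ) → ℝ) (V : Fin n → Fin k → ℝ) (Y : Fin n → ℝ)
    (h : (Fin p → ℝ) → Fin m → ℝ) (Ω : Set (Fin m → ℝ)) (q : ℝ≥0∞) (r : ℝ)
    (θ : Fin p → ℝ) (μ : Fin L → ℝ) : Prop :=
  lqNorm q (fun j => (1 / (n : ℝ)) * ∑ i, X i j * (Y i - g (V i) θ) - μ j) ≤ r ∧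
    h θ ∈ Ω

/-- Optimality for the alternative program (p1-1): feasible with minimal `‖μ‖_{q̃}`. -/
def OptimalP1 {n L k p m : ℕ} (X : Fin n → Fin L → ℝ)
    (g : (Fin k → ℝ) → (Fin p → ℝ) → ℝ) (V : Fin n → Fin k → ℝ) (Y : Fin n → ℝ)
    (h : (Fin p → ℝ) → Fin m → ℝ) (Ω : Set (Fin m → ℝ)) (q qt : ℝ≥0∞) (r : ℝ)
    (θ : Fin p → ℝ) (μ : Fin L → ℝ) : Prop :=
  FeasibleP1 X g V Y h Ω q r θ μ ∧
    ∀ θ' μ', FeasibleP1 X g V Y h Ω q r θ' μ' → lqNorm qt μ ≤ lqNorm qt μ'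

section Helpers
open scoped Pointwise

lemma bm_compact {A B C : Set ℝ} (hA : IsCompact A) (hB : IsCompact B)
    (hA0 : A.Nonempty) (hB0 : B.Nonempty)
    (hC : ∀ x ∈ A, ∀ y ∈ B, x + y ∈ C) : volume A + volume B ≤ volume C := by
  obtain ⟨a, haA, ha⟩ := hA.exists_isGreatest hA0
  obtain ⟨b, hbB, hb⟩ := hB.exists_isLeast hB0
  have h1 : volume A = volume ((fun x => x + b) '' A) := by
    rw [Set.image_add_right, measure_preimage_add_right]
  have h2 : volume B = volume ((fun x => a + x) '' B) := by
    rw [Set.image_add_left, measure_preimage_add]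
  have hd : AEDisjoint volume ((fun x => x + b) '' A) ((fun x => a + x) '' B) := by
    refine measure_mono_null (t := {a + b}) ?_ (by simp)
    rintro z ⟨⟨x, hx, rfl⟩, ⟨y, hy, hxy⟩⟩
    have := ha hx
    have := hb hy
    simp only [Set.mem_singleton_iff] at *
    linarith
  have hm : MeasurableSet ((fun x => a + x) '' B) :=
    (hB.image (by fun_prop)).measurableSet
  rw [h1, h2, ← measure_union₀ hm.nullMeasurableSet hd]
  apply measure_mono
  rintro z (⟨x, hx, rfl⟩ | ⟨y, hy, rfl⟩)
  · exact hC _ hx _ hbB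
  · exact hC _ haA _ hy

lemma bm_meas {A B C : Set ℝ} (hA : MeasurableSet A) (hB : MeasurableSet B)
    (hA0 : A.Nonempty) (hB0 : B.Nonempty) {s t : ℝ} (hs : 0 < s) (ht : 0 < t)
    (hC : ∀ x ∈ A, ∀ y ∈ B, s * x + t * y ∈ C) :
    ENNReal.ofReal s * volume A + ENNReal.ofReal t * volume B ≤ volume C := by
  obtain ⟨a, ha⟩ := hA0
  obtain ⟨b, hb⟩ := hB0
  have key : ∀ K, K ⊆ A → IsCompact K → ∀ K', K' ⊆ B → IsCompact K' →
      ENNReal.ofReal s * volume K + ENNReal.ofReal t * volume K' ≤ volume C := by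
    intro K hK hKc K' hK' hKc'
    have := bm_compact (A := (fun x => s * x) '' (insert a K)) (B := (fun x => t * x) '' (insert b K'))
      (C := C) ((hKc.insert a).image (by fun_prop)) ((hKc'.insert b).image (by fun_prop))
      (by simp) (by simp) (by
        rintro _ ⟨x, hx, rfl⟩ _ ⟨y, hy, rfl⟩
        exact hC _ (Set.insert_subset ha hK hx) _ (Set.insert_subset hb hK' hy))
    refine le_trans ?_ this
    have e1 := Measure.addHaar_smul volume s (insert a K)
    have e2 := Measure.addHaar_smul volume t (insert b K')
    simp only [Module.finrank_self, pow_one, abs_of_pos hs, abs_of_pos ht] at e1 e2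
    change _ ≤ volume (s • (insert a K)) + volume (t • (insert b K'))
    rw [e1, e2]
    gcongr <;> exact Set.subset_insert _ _
  rw [hA.measure_eq_iSup_isCompact, hB.measure_eq_iSup_isCompact]
  simp only [ENNReal.mul_iSup, iSup_and']
  exact ENNReal.biSup_add_biSup_le' ⟨∅, by simp⟩ ⟨∅, by simp⟩
    fun K hK K' hK' => key K hK.1 hK.2 K' hK'.1 hK'.2

lemma pl_core {f g h : ℝ → ℝ} (hf : Measurable f) (hg : Measurable g) (hh : Measurable h)
    (hf0 : ∀ x, 0 ≤ f x) (hg0 : ∀ x, 0 ≤ g x) (hh0 : ∀ x, 0 ≤ h x)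
    (hf1 : ∀ x, f x ≤ 1) (hg1 : ∀ x, g x ≤ 1)
    (hfs : ∀ l < 1, ∃ x, l < f x) (hgs : ∀ l < 1, ∃ x, l < g x)
    {s t : ℝ} (hs : 0 < s) (ht : 0 < t) (hst : s + t = 1)
    (H : ∀ x y, f x ^ s * g y ^ t ≤ h (s * x + t * y)) :
    ENNReal.ofReal s * (∫⁻ x, ENNReal.ofReal (f x)) + ENNReal.ofReal t * (∫⁻ x, ENNReal.ofReal (g x))
      ≤ ∫⁻ x, ENNReal.ofReal (h x) := by
  rw [lintegral_eq_lintegral_meas_lt _ (.of_forall hf0) hf.aemeasurable,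
    lintegral_eq_lintegral_meas_lt _ (.of_forall hg0) hg.aemeasurable,
    lintegral_eq_lintegral_meas_lt _ (.of_forall hh0) hh.aemeasurable]
  have mf : Measurable fun l : ℝ => volume {a | l < f a} :=
    Antitone.measurable fun a b hab => measure_mono fun x hx => lt_of_le_of_lt hab hx
  rw [← lintegral_const_mul' _ _ ENNReal.ofReal_ne_top, ← lintegral_const_mul' _ _ ENNReal.ofReal_ne_top,
    ← lintegral_add_left (mf.const_mul _)]
  refine setLIntegral_mono' measurableSet_Ioi fun l hl => ?_
  have hl : 0 < l := hl
  by_cases h1 : l < 1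
  · refine bm_meas (measurableSet_lt measurable_const hf) (measurableSet_lt measurable_const hg)
      (hfs l h1) (hgs l h1) hs ht ?_
    intro x hx y hy
    refine lt_of_lt_of_le ?_ (H x y)
    calc l = l ^ s * l ^ t := by rw [← Real.rpow_add hl, hst, Real.rpow_one]
      _ < _ := mul_lt_mul'' (Real.rpow_lt_rpow hl.le hx hs) (Real.rpow_lt_rpow hl.le hy ht)
        (by positivity) (by positivity)
  · have e1 : {a | l < f a} = ∅ := by
      ext x; simp; linarith [hf1 x]
    have e2 : {a | l < g a} = ∅ := by
      ext x; simp; linarith [hg1 x]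
    simp [e1, e2]

lemma amgm {a b : ℝ≥0∞} {s t : ℝ} (hs : 0 < s) (ht : 0 < t) (hst : s + t = 1) :
    a ^ s * b ^ t ≤ ENNReal.ofReal s * a + ENNReal.ofReal t * b := by
  by_cases ha : a = ⊤
  · subst ha
    rw [ENNReal.mul_top (by simpa using hs)]; simp
  by_cases hb : b = ⊤
  · subst hb
    rw [ENNReal.mul_top (by simpa using ht)]; simp
  lift a to ℝ≥0 using ha
  lift b to ℝ≥0 using hb
  have := NNReal.geom_mean_le_arith_mean2_weighted ⟨s, hs.le⟩ ⟨t, ht.le⟩ a b (NNReal.eq hst)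
  rw [← ENNReal.coe_rpow_of_nonneg _ hs.le, ← ENNReal.coe_rpow_of_nonneg _ ht.le,
    ENNReal.ofReal_eq_coe_nnreal hs.le, ENNReal.ofReal_eq_coe_nnreal ht.le]
  exact_mod_cast this

/-- bounded real version -/
lemma pl_bdd {f g h : ℝ → ℝ} (hf : Measurable f) (hg : Measurable g) (hh : Measurable h)
    (hf0 : ∀ x, 0 ≤ f x) (hg0 : ∀ x, 0 ≤ g x) (hh0 : ∀ x, 0 ≤ h x)
    {N : ℝ} (hf1 : ∀ x, f x ≤ N) (hg1 : ∀ x, g x ≤ N)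
    {s t : ℝ} (hs : 0 < s) (ht : 0 < t) (hst : s + t = 1)
    (H : ∀ x y, f x ^ s * g y ^ t ≤ h (s * x + t * y)) :
    (∫⁻ x, ENNReal.ofReal (f x)) ^ s * (∫⁻ x, ENNReal.ofReal (g x)) ^ t
      ≤ ∫⁻ x, ENNReal.ofReal (h x) := by
  have bf : BddAbove (Set.range f) := ⟨N, by rintro _ ⟨x, rfl⟩; exact hf1 x⟩
  have bg : BddAbove (Set.range g) := ⟨N, by rintro _ ⟨x, rfl⟩; exact hg1 x⟩
  set a := ⨆ x, f x with ha
  set b := ⨆ x, g x with hb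
  have fa : ∀ x, f x ≤ a := le_ciSup bf
  have gb : ∀ x, g x ≤ b := le_ciSup bg
  rcases (le_trans (hf0 0) (fa 0)).eq_or_lt with a0 | a0
  · have : ∀ x, f x = 0 := fun x => le_antisymm (a0 ▸ fa x) (hf0 x)
    simp [this, hs]
  rcases (le_trans (hg0 0) (gb 0)).eq_or_lt with b0 | b0
  · have : ∀ x, g x = 0 := fun x => le_antisymm (b0 ▸ gb x) (hg0 x)
    simp [this, ht]
  have core := pl_core (f := fun x => a⁻¹ * f x) (g := fun x => b⁻¹ * g x)
    (h := fun x => (a ^ s * b ^ t)⁻¹ * h x) (hf.const_mul _) (hg.const_mul _) (hh.const_mul _)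
    (fun x => mul_nonneg (by positivity) (hf0 x)) (fun x => mul_nonneg (by positivity) (hg0 x))
    (fun x => mul_nonneg (by positivity) (hh0 x))
    (fun x => by rw [inv_mul_le_one₀ a0]; exact fa x)
    (fun x => by rw [inv_mul_le_one₀ b0]; exact gb x)
    (fun l hl => by
      obtain ⟨x, hx⟩ := exists_lt_of_lt_ciSup (show l * a < ⨆ x, f x by rw [← ha]; nlinarith)
      exact ⟨x, by rw [lt_inv_mul_iff₀ a0]; linarith⟩)
    (fun l hl => by
      obtain ⟨x, hx⟩ := exists_lt_of_lt_ciSup (show l * b < ⨆ x, g x by rw [← hb]; nlinarith)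
      exact ⟨x, by rw [lt_inv_mul_iff₀ b0]; linarith⟩)
    hs ht hst (fun x y => by
      rw [Real.mul_rpow (by positivity) (hf0 x), Real.mul_rpow (by positivity) (hg0 y),
        Real.inv_rpow a0.le, Real.inv_rpow b0.le, mul_inv]
      calc _ = ((a ^ s)⁻¹ * (b ^ t)⁻¹) * (f x ^ s * g y ^ t) := by ring
        _ ≤ _ := mul_le_mul_of_nonneg_left (H x y) (by positivity))
  have core2 := (amgm hs ht hst).trans core
  have c0 : 0 < a ^ s * b ^ t := by positivity
  have sc : ∀ (c : ℝ) (F : ℝ → ℝ), 0 < c → ∫⁻ x, ENNReal.ofReal (c⁻¹ * F x) =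
      (ENNReal.ofReal c)⁻¹ * ∫⁻ x, ENNReal.ofReal (F x) := by
    intro c F hc
    rw [← lintegral_const_mul' _ _ (by simpa using hc), ← ENNReal.ofReal_inv_of_pos hc]
    simp_rw [ENNReal.ofReal_mul (inv_nonneg.2 hc.le)]
  rw [sc a f a0, sc b g b0, sc _ h c0, ENNReal.mul_rpow_of_nonneg _ _ hs.le,
    ENNReal.mul_rpow_of_nonneg _ _ ht.le, ENNReal.inv_rpow, ENNReal.inv_rpow,
    ENNReal.ofReal_rpow_of_pos a0, ENNReal.ofReal_rpow_of_pos b0] at core2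
  rw [ENNReal.ofReal_mul (by positivity)] at core2
  have p1 : 0 < a ^ s := by positivity
  have p2 : 0 < b ^ t := by positivity
  rw [ENNReal.mul_inv (by simp) (by simp)] at core2
  rw [mul_mul_mul_comm] at core2
  rwa [ENNReal.mul_le_mul_iff_right] at core2
  · simp
  · simp [ENNReal.mul_eq_top, p1, p2]

lemma pl_one {f g h : ℝ → ℝ≥0∞} (hf : Measurable f) (hg : Measurable g) (hh : Measurable h)
    {s t : ℝ} (hs : 0 < s) (ht : 0 < t) (hst : s + t = 1)
    (H : ∀ x y, f x ^ s * g y ^ t ≤ h (s * x + t * y)) :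
    (∫⁻ x, f x) ^ s * (∫⁻ x, g x) ^ t ≤ ∫⁻ x, h x := by
  have key : ∀ N : ℕ, (∫⁻ x, min (f x) N) ^ s * (∫⁻ x, min (g x) N) ^ t ≤ ∫⁻ x, h x := by
    intro N
    have ft : ∀ (F : ℝ → ℝ≥0∞) x, min (F x) N ≠ ⊤ := fun F x => by simp
    have := pl_bdd (f := fun x => (min (f x) N).toReal) (g := fun x => (min (g x) N).toReal)
      (h := fun x => (min (h x) N).toReal) (by fun_prop) (by fun_prop) (by fun_prop)
      (by simp) (by simp) (by simp) (N := N)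
      (fun x => ENNReal.toReal_le_of_le_ofReal (by simp) (by simp))
      (fun x => ENNReal.toReal_le_of_le_ofReal (by simp) (by simp)) hs ht hst (by
        intro x y
        rw [ENNReal.toReal_rpow, ENNReal.toReal_rpow, ← ENNReal.toReal_mul]
        refine ENNReal.toReal_mono (ft _ _) (le_min ?_ ?_)
        · refine le_trans ?_ (H x y)
          gcongr <;> exact min_le_left _ _
        · calc _ ≤ (N : ℝ≥0∞) ^ s * (N : ℝ≥0∞) ^ t := by gcongr <;> exact min_le_right _ _
            _ = N := by rw [← ENNReal.rpow_add_of_nonneg _ _ hs.le ht.le, hst, ENNReal.rpow_one])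
    simp_rw [ENNReal.ofReal_toReal (ft _ _)] at this
    exact this.trans (lintegral_mono fun x => min_le_left _ _)
  have lim : ∀ F : ℝ → ℝ≥0∞, Measurable F →
      Filter.Tendsto (fun N : ℕ => ∫⁻ x, min (F x) N) Filter.atTop (nhds (∫⁻ x, F x)) := by
    intro F hF
    refine lintegral_tendsto_of_tendsto_of_monotone (fun N => by fun_prop) (.of_forall fun x => ?_)
      (.of_forall fun x => ?_)
    · intro N M hNM
      dsimp only
      gcongr
    · have := (tendsto_const_nhds (x := F x)).min ENNReal.tendsto_nat_nhds_top
      simpa using this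
  by_cases f0 : ∫⁻ x, f x = 0
  · simp [f0, hs]
  by_cases g0 : ∫⁻ x, g x = 0
  · simp [g0, ht]
  refine le_of_tendsto' (ENNReal.Tendsto.mul ((ENNReal.continuous_rpow_const.tendsto _).comp (lim f hf)) ?_
    ((ENNReal.continuous_rpow_const.tendsto _).comp (lim g hg)) ?_) key
  · left; simp [f0, hs.not_gt]
  · left; simp [g0, ht.not_gt]

lemma pdf_id {v : ℝ≥0} (hv : v ≠ 0) {s t : ℝ} (hst : s + t = 1)
    (x y : ℝ) : gaussianPDF 0 v x ^ s * gaussianPDF 0 v y ^ t *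
      ENNReal.ofReal (Real.exp (s * t * (x - y) ^ 2 / (2 * v))) = gaussianPDF 0 v (s * x + t * y) := by
  have hx := gaussianPDFReal_pos 0 v x hv
  have hy := gaussianPDFReal_pos 0 v y hv
  have hv' : (0 : ℝ) < v := by positivity
  unfold gaussianPDF
  rw [ENNReal.ofReal_rpow_of_pos hx, ENNReal.ofReal_rpow_of_pos hy,
    ← ENNReal.ofReal_mul (by positivity), ← ENNReal.ofReal_mul (by positivity)]
  congr 1
  unfold gaussianPDFReal
  set c := (√(2 * Real.pi * v))⁻¹ with hc
  have c0 : 0 < c := by positivity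
  rw [Real.mul_rpow c0.le (Real.exp_pos _).le, Real.mul_rpow c0.le (Real.exp_pos _).le,
    ← Real.exp_mul, ← Real.exp_mul]
  have : c = c ^ s * c ^ t := by rw [← Real.rpow_add c0, hst, Real.rpow_one]
  calc _ = (c ^ s * c ^ t) * (Real.exp (-(x - 0) ^ 2 / (2 * v) * s) * Real.exp (-(y - 0) ^ 2 / (2 * v) * t) *
        Real.exp (s * t * (x - y) ^ 2 / (2 * v))) := by ring
    _ = _ := by
      rw [← this, ← Real.exp_add, ← Real.exp_add]
      congr 2
      obtain rfl : t = 1 - s := by linarith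
      field_simp
      ring

lemma gpl_one {v : ℝ≥0} (hv : v ≠ 0) {f g h : ℝ → ℝ≥0∞} (hf : Measurable f) (hg : Measurable g)
    (hh : Measurable h)
    {s t : ℝ} (hs : 0 < s) (ht : 0 < t) (hst : s + t = 1)
    (H : ∀ x y, f x ^ s * g y ^ t ≤ h (s * x + t * y) *
      ENNReal.ofReal (Real.exp (s * t * (x - y) ^ 2 / (2 * v)))) :
    (∫⁻ x, f x ∂(gaussianReal 0 v)) ^ s * (∫⁻ x, g x ∂(gaussianReal 0 v)) ^ t
      ≤ ∫⁻ x, h x ∂(gaussianReal 0 v) := by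
  have mp := measurable_gaussianPDF 0 v
  rw [gaussianReal_of_var_ne_zero _ hv, lintegral_withDensity_eq_lintegral_mul _ mp hf,
    lintegral_withDensity_eq_lintegral_mul _ mp hg, lintegral_withDensity_eq_lintegral_mul _ mp hh]
  refine pl_one (mp.mul hf) (mp.mul hg) (mp.mul hh) hs ht hst fun x y => ?_
  simp only [Pi.mul_apply]
  rw [ENNReal.mul_rpow_of_nonneg _ _ hs.le, ENNReal.mul_rpow_of_nonneg _ _ ht.le,
    mul_mul_mul_comm, ← pdf_id hv hst]
  refine (mul_le_mul_right (H x y) (gaussianPDF 0 v x ^ s * gaussianPDF 0 v y ^ t)).trans_eq ?_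
  ring

lemma gpl {v : ℝ≥0} (hv : v ≠ 0) {s t : ℝ} (hs : 0 < s) (ht : 0 < t) (hst : s + t = 1) (n : ℕ) :
    ∀ {f g h : (Fin n → ℝ) → ℝ≥0∞}, Measurable f → Measurable g → Measurable h →
    (∀ x y, f x ^ s * g y ^ t ≤ h (fun i => s * x i + t * y i) *
      ENNReal.ofReal (Real.exp (s * t * (∑ i, (x i - y i) ^ 2) / (2 * v)))) →
    (∫⁻ x, f x ∂(Measure.pi fun _ => gaussianReal 0 v)) ^ s *
      (∫⁻ x, g x ∂(Measure.pi fun _ => gaussianReal 0 v)) ^ t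
      ≤ ∫⁻ x, h x ∂(Measure.pi fun _ => gaussianReal 0 v) := by
  induction n with
  | zero =>
    intro f g h hf hg hh H
    have := H default default
    simp only [Measure.pi_of_empty _ default, lintegral_dirac]
    convert this using 1
    simp
    congr 1
    exact Subsingleton.elim _ _
  | succ n ih =>
    intro f g h hf hg hh H
    have e : ∀ F : (Fin (n + 1) → ℝ) → ℝ≥0∞, Measurable F →
        ∫⁻ x, F x ∂(Measure.pi fun _ => gaussianReal 0 v) =
        ∫⁻ a, ∫⁻ x, F (Fin.cons a x) ∂(Measure.pi fun _ => gaussianReal 0 v) ∂(gaussianReal 0 v) := by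
      intro F hF
      have := (measurePreserving_piFinSuccAbove (fun _ : Fin (n + 1) => gaussianReal 0 v) 0).symm
      rw [← this.lintegral_comp hF, lintegral_prod _ (by
        exact (hF.comp (MeasurableEquiv.measurable _)).aemeasurable)]
      simp [MeasurableEquiv.piFinSuccAbove, Fin.insertNthEquiv]
    have mc : Measurable fun p : ℝ × (Fin n → ℝ) => (Fin.cons p.1 p.2 : Fin (n + 1) → ℝ) := by
      refine measurable_pi_iff.2 fun i => ?_
      refine Fin.cases ?_ (fun j => ?_) i
      · simpa using measurable_fst
      · simp only [Fin.cons_succ]; fun_prop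
    have mi : ∀ F : (Fin (n + 1) → ℝ) → ℝ≥0∞, Measurable F → Measurable fun a =>
        ∫⁻ x, F (Fin.cons a x) ∂(Measure.pi fun _ : Fin n => gaussianReal 0 v) := by
      intro F hF
      exact (hF.comp mc).lintegral_prod_right'
    have ms : ∀ F : (Fin (n + 1) → ℝ) → ℝ≥0∞, Measurable F → ∀ a, Measurable fun x : Fin n → ℝ =>
        F (Fin.cons a x) := fun F hF a => (hF.comp mc).comp measurable_prodMk_left
    rw [e f hf, e g hg, e h hh]
    refine gpl_one hv (mi f hf) (mi g hg) (mi h hh) hs ht hst fun a b => ?_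
    rw [← lintegral_mul_const' _ _ ENNReal.ofReal_ne_top]
    refine ih (ms f hf a) (ms g hg b) ((ms h hh _).mul_const _) fun x y => ?_
    refine (H _ _).trans_eq ?_
    rw [mul_assoc (h _), ← ENNReal.ofReal_mul (by positivity), ← Real.exp_add, Fin.sum_univ_succ]
    congr 2
    · ext i
      refine Fin.cases ?_ (fun j => ?_) i <;> simp
    · simp only [Fin.cons_zero, Fin.cons_succ]
      congr 1
      ring

/-- Gaussian concentration (Laplace transform), sharp constant. -/
lemma conc {v : ℝ≥0} (hv : v ≠ 0) {n : ℕ} {F : (Fin n → ℝ) → ℝ} (hF : Measurable F)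
    (hI : Integrable F (Measure.pi fun _ => gaussianReal 0 v)) {K : ℝ}
    (hL : ∀ x y, |F x - F y| ≤ K * √(∑ i, (x i - y i) ^ 2)) (l : ℝ) :
    ∫⁻ x, ENNReal.ofReal (Real.exp (l * F x)) ∂(Measure.pi fun _ => gaussianReal 0 v)
      ≤ ENNReal.ofReal (Real.exp (l * (∫ x, F x ∂(Measure.pi fun _ => gaussianReal 0 v)) +
        v * K ^ 2 * l ^ 2 / 2)) := by
  set P : Measure (Fin n → ℝ) := Measure.pi fun _ => gaussianReal 0 v with hP
  have hv' : (0 : ℝ) < v := by positivity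
  set m := ∫ x, F x ∂P
  -- Step 1: for each t
  have step : ∀ t : ℝ, 0 < t → t < 1 → ∫⁻ x, ENNReal.ofReal (Real.exp (l * F x)) ∂P
      ≤ ENNReal.ofReal (Real.exp (l * m + v * K ^ 2 * l ^ 2 / (2 * t))) := by
    intro t ht ht1
    set s := 1 - t with hs'
    have hs : 0 < s := by simp only [hs']; linarith
    have hst : s + t = 1 := by simp [hs']
    set c := v * K ^ 2 * l ^ 2 / (2 * t) with hc
    have main := gpl hv hs ht hst n (f := fun x => ENNReal.ofReal (Real.exp (l * F x)))
      (g := fun x => ENNReal.ofReal (Real.exp (-(s / t) * l * F x)))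
      (h := fun x => ENNReal.ofReal (Real.exp (s * c)))
      (by fun_prop) (by fun_prop) (by fun_prop) (by
        intro x y
        rw [ENNReal.ofReal_rpow_of_pos (Real.exp_pos _), ENNReal.ofReal_rpow_of_pos (Real.exp_pos _),
          ← ENNReal.ofReal_mul (by positivity), ← ENNReal.ofReal_mul (by positivity),
          ← Real.exp_mul, ← Real.exp_mul, ← Real.exp_add, ← Real.exp_add]
        apply ENNReal.ofReal_le_ofReal
        apply Real.exp_le_exp.2
        set D := ∑ i, (x i - y i) ^ 2
        have hD : 0 ≤ D := Finset.sum_nonneg fun i _ => sq_nonneg _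
        set d := √D with hd
        have hdD : D = d ^ 2 := (Real.sq_sqrt hD).symm
        have h1 : l * (F x - F y) ≤ |l| * (K * d) := by
          calc _ ≤ |l * (F x - F y)| := le_abs_self _
            _ = |l| * |F x - F y| := abs_mul _ _
            _ ≤ _ := by gcongr; exact hL x y
        have h2 : |l| * (K * d) ≤ c + t * d ^ 2 / (2 * v) := by
          have : c + t * d ^ 2 / (2 * v) - |l| * (K * d) = (v * K * |l| - t * d) ^ 2 / (2 * t * v) := by
            rw [hc, ← sq_abs l]
            field_simp
            ring
          have h0 : 0 ≤ (v * K * |l| - t * d) ^ 2 / (2 * t * v) := by positivity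
          linarith
        have h3 : l * F x * s + -(s / t) * l * F y * t = s * (l * (F x - F y)) := by
          field_simp
          ring
        rw [h3, hdD]
        calc _ ≤ s * (c + t * d ^ 2 / (2 * v)) := by gcongr; exact h1.trans h2
          _ = _ := by ring)
    have jen : ENNReal.ofReal (Real.exp (-(s / t) * l * m)) ≤
        ∫⁻ x, ENNReal.ofReal (Real.exp (-(s / t) * l * F x)) ∂P := by
      by_cases hi : Integrable (fun x => Real.exp (-(s / t) * l * F x)) P
      · rw [← ofReal_integral_eq_lintegral_ofReal hi (.of_forall fun x => (Real.exp_pos _).le)]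
        apply ENNReal.ofReal_le_ofReal
        have := convexOn_exp.map_integral_le (μ := P) (f := fun x => -(s / t) * l * F x)
          Real.continuous_exp.continuousOn isClosed_univ (by simp) (hI.const_mul _) hi
        rwa [integral_const_mul] at this
      · have : ∫⁻ x, ENNReal.ofReal (Real.exp (-(s / t) * l * F x)) ∂P = ⊤ := by
          by_contra hne
          exact hi ((lintegral_ofReal_ne_top_iff_integrable (by fun_prop)
            (.of_forall fun x => (Real.exp_pos _).le)).1 hne)
        rw [this]; exact le_top
    set A := ∫⁻ x, ENNReal.ofReal (Real.exp (l * F x)) ∂P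
    have m2 : A ^ s * ENNReal.ofReal (Real.exp (-(s / t) * l * m)) ^ t ≤
        ENNReal.ofReal (Real.exp (s * c)) := by
      refine le_trans ?_ (main.trans_eq (by simp))
      gcongr
    rw [ENNReal.ofReal_rpow_of_pos (Real.exp_pos _), ← Real.exp_mul] at m2
    have m3 : A ^ s ≤ ENNReal.ofReal (Real.exp (l * m + c)) ^ s := by
      rw [ENNReal.ofReal_rpow_of_pos (Real.exp_pos _), ← Real.exp_mul]
      have e1 : Real.exp ((l * m + c) * s) = Real.exp (s * c) * Real.exp (s * l * m) := by
        rw [← Real.exp_add]; ring_nf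
      rw [e1, ENNReal.ofReal_mul (by positivity)]
      calc A ^ s = A ^ s * ENNReal.ofReal (Real.exp (-(s / t) * l * m * t)) *
            ENNReal.ofReal (Real.exp (s * l * m)) := by
            rw [mul_assoc, ← ENNReal.ofReal_mul (by positivity), ← Real.exp_add]
            have : -(s / t) * l * m * t + s * l * m = 0 := by field_simp; ring
            rw [this]; simp
        _ ≤ _ := by gcongr
    exact (ENNReal.rpow_le_rpow_iff hs).1 m3
  have lim : Filter.Tendsto (fun t : ℝ => ENNReal.ofReal (Real.exp (l * m + v * K ^ 2 * l ^ 2 / (2 * t))))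
      (nhdsWithin 1 (Set.Iio 1)) (nhds (ENNReal.ofReal (Real.exp (l * m + v * K ^ 2 * l ^ 2 / 2)))) := by
    refine Filter.Tendsto.mono_left ?_ nhdsWithin_le_nhds
    refine (ENNReal.continuous_ofReal.tendsto _).comp ((Real.continuous_exp.tendsto _).comp ?_)
    refine tendsto_const_nhds.add ?_
    refine tendsto_const_nhds.div ?_ (by norm_num)
    have : ContinuousAt (fun t : ℝ => 2 * t) 1 := by fun_prop
    simpa [ContinuousAt] using this
  refine ge_of_tendsto lim ?_
  filter_upwards [Ioo_mem_nhdsLT (show (0 : ℝ) < 1 by norm_num)] with t ht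
  exact step t ht.1 ht.2

lemma conc_tail {v : ℝ≥0} (hv : v ≠ 0) {n : ℕ} {F : (Fin n → ℝ) → ℝ} (hF : Measurable F)
    (hI : Integrable F (Measure.pi fun _ => gaussianReal 0 v)) {K : ℝ≥0}
    (hL : ∀ x y, |F x - F y| ≤ K * √(∑ i, (x i - y i) ^ 2)) {r : ℝ} (hr : 0 ≤ r) :
    (Measure.pi fun _ => gaussianReal 0 v).real
      {x | r ≤ F x - ∫ x, F x ∂(Measure.pi fun _ => gaussianReal 0 v)} ≤
      Real.exp (-r ^ 2 / (2 * (v * K ^ 2))) := by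
  set P : Measure (Fin n → ℝ) := Measure.pi fun _ => gaussianReal 0 v with hP
  set m := ∫ x, F x ∂P
  have b : ∀ l : ℝ, ∫⁻ x, ENNReal.ofReal (Real.exp (l * (F x - m))) ∂P ≤
      ENNReal.ofReal (Real.exp (v * K ^ 2 * l ^ 2 / 2)) := by
    intro l
    have h1 := conc hv hF hI hL l
    have e1 : ∀ x, ENNReal.ofReal (Real.exp (l * (F x - m))) =
        ENNReal.ofReal (Real.exp (-(l * m))) * ENNReal.ofReal (Real.exp (l * F x)) := by
      intro x
      rw [← ENNReal.ofReal_mul (by positivity), ← Real.exp_add]; ring_nf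
    simp_rw [e1]
    rw [lintegral_const_mul' _ _ ENNReal.ofReal_ne_top]
    refine (mul_le_mul_right h1 _).trans_eq ?_
    rw [← ENNReal.ofReal_mul (by positivity), ← Real.exp_add]
    congr 2
    change -(l * m) + (l * m + v * K ^ 2 * l ^ 2 / 2) = _
    ring
  have sg : HasSubgaussianMGF (fun x => F x - m) (v * K ^ 2) P := by
    have int : ∀ l : ℝ, Integrable (fun x => Real.exp (l * (F x - m))) P := fun l =>
      (lintegral_ofReal_ne_top_iff_integrable (by fun_prop)
        (.of_forall fun x => (Real.exp_pos _).le)).1 (ne_top_of_le_ne_top ENNReal.ofReal_ne_top (b l))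
    refine ⟨int, fun l => ?_⟩
    have := b l
    rw [← ofReal_integral_eq_lintegral_ofReal (int l) (.of_forall fun x => (Real.exp_pos _).le),
      ENNReal.ofReal_le_ofReal_iff (by positivity)] at this
    simpa [mgf] using this
  simpa using sg.measure_ge_le hr

lemma lq_mem (q : ℝ≥0∞) {L : ℕ} (u : Fin L → ℝ) : MemLp u q Measure.count := MemLp.of_discrete

lemma lq_nonneg (q : ℝ≥0∞) {L : ℕ} (u : Fin L → ℝ) : 0 ≤ lqNorm q u := ENNReal.toReal_nonneg

lemma lq_add {q : ℝ≥0∞} (hq : 1 ≤ q) {L : ℕ} (u v : Fin L → ℝ) :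
    lqNorm q (fun j => u j + v j) ≤ lqNorm q u + lqNorm q v := by
  unfold lqNorm
  rw [← ENNReal.toReal_add (lq_mem q u).2.ne (lq_mem q v).2.ne]
  exact ENNReal.toReal_mono (ENNReal.add_ne_top.2 ⟨(lq_mem q u).2.ne, (lq_mem q v).2.ne⟩)
    (eLpNorm_add_le (lq_mem q u).1 (lq_mem q v).1 hq)

lemma lq_mono (q : ℝ≥0∞) {L : ℕ} {u v : Fin L → ℝ} (h : ∀ j, |u j| ≤ v j) :
    lqNorm q u ≤ lqNorm q v :=
  ENNReal.toReal_mono (lq_mem q v).2.ne (eLpNorm_mono_real h)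

lemma lq_mul (q : ℝ≥0∞) {L : ℕ} {c : ℝ} (hc : 0 ≤ c) (u : Fin L → ℝ) :
    lqNorm q (fun j => c * u j) = c * lqNorm q u := by
  have := eLpNorm_const_smul c u q Measure.count
  unfold lqNorm
  change (eLpNorm (c • u) q Measure.count).toReal = _
  rw [this, ENNReal.toReal_mul]
  simp [abs_of_nonneg hc]

lemma lq_neg (q : ℝ≥0∞) {L : ℕ} (u : Fin L → ℝ) : lqNorm q (fun j => - u j) = lqNorm q u := by
  unfold lqNorm
  congr 1
  exact eLpNorm_neg u q _

lemma lq_lin (q : ℝ≥0∞) {n L : ℕ} (hn : 1 ≤ n) (X : Fin n → Fin L → ℝ) (w : Fin n → ℝ) :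
    lqNorm q (fun j => (1 / (n : ℝ)) * ∑ i, X i j * w i) ≤
      Nq q X / √n * √(∑ i, w i ^ 2) := by
  have hn' : (0 : ℝ) < n := by exact_mod_cast hn
  have : Nq q X / √n * √(∑ i, w i ^ 2) = lqNorm q (fun j => (√(∑ i, w i ^ 2) / √n) *
      √((1 / (n : ℝ)) * ∑ i, (X i j) ^ 2)) := by
    rw [lq_mul q (by positivity), Nq]; ring
  rw [this]
  apply lq_mono
  intro j
  have cs : |∑ i, X i j * w i| ≤ √(∑ i, X i j ^ 2) * √(∑ i, w i ^ 2) := by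
    rw [← Real.sqrt_mul (Finset.sum_nonneg fun i _ => sq_nonneg _)]
    exact Real.abs_le_sqrt (Finset.sum_mul_sq_le_sq_mul_sq _ _ _)
  rw [abs_mul, abs_of_nonneg (by positivity), Real.sqrt_mul (by positivity),
    Real.sqrt_div (by norm_num), Real.sqrt_one]
  calc _ ≤ 1 / (n : ℝ) * (√(∑ i, X i j ^ 2) * √(∑ i, w i ^ 2)) := by gcongr
    _ = 1 / (√n * √n) * (√(∑ i, X i j ^ 2) * √(∑ i, w i ^ 2)) := by
      rw [Real.mul_self_sqrt hn'.le]
    _ = _ := by field_simp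

lemma sqrt_sum_le {n : ℕ} (w : Fin n → ℝ) : √(∑ i, w i ^ 2) ≤ ∑ i, |w i| := by
  apply Real.sqrt_le_iff.2 ⟨Finset.sum_nonneg fun i _ => abs_nonneg _, ?_⟩
  have := Finset.sum_sq_le_sq_sum_of_nonneg (s := Finset.univ) (f := fun i => |w i|)
    (fun i _ => abs_nonneg _)
  simpa using this

lemma pi_prob (n : ℕ) (v : ℝ≥0) :
    IsProbabilityMeasure (Measure.pi fun _ : Fin n => gaussianReal 0 v) := inferInstance

lemma tail_event {n L : ℕ} (hn : 1 ≤ n) (X : Fin n → Fin L → ℝ) {σ : ℝ} (hσ : 0 < σ)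
    {q : ℝ≥0∞} (hq : 1 ≤ q) {α : ℝ} (hα : α ∈ Set.Ioo (0 : ℝ) 1) :
    (gaussianVec n σ).real {w | lqNorm q (fun j => (1 / (n : ℝ)) * ∑ i, X i j * w i) ≤
      (∫ w', lqNorm q (fun j => (1 / (n : ℝ)) * ∑ i, X i j * w' i) ∂(gaussianVec n σ)) +
                σ * Nq q X * Real.sqrt ((2 / (n : ℝ)) * Real.log (1 / α))} ≥ 1 - α := by
  have hn' : (0 : ℝ) < n := by exact_mod_cast hn
  set v : ℝ≥0 := ⟨σ ^ 2, sq_nonneg σ⟩ with hvdef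
  have hvσ : (v : ℝ) = σ ^ 2 := rfl
  have hv : v ≠ 0 := by
    intro h0
    have : (v : ℝ) = 0 := by rw [h0]; rfl
    rw [hvσ] at this
    exact (pow_pos hσ 2).ne' this
  set F : (Fin n → ℝ) → ℝ := fun w => lqNorm q (fun j => (1 / (n : ℝ)) * ∑ i, X i j * w i) with hFdef
  have hPdef : gaussianVec n σ = Measure.pi fun _ => gaussianReal 0 v := rfl
  rw [hPdef]
  set P : Measure (Fin n → ℝ) := Measure.pi fun _ => gaussianReal 0 v with hP
  have hN : 0 ≤ Nq q X := lq_nonneg _ _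
  set K : ℝ≥0 := ⟨Nq q X / √n, by positivity⟩ with hKdef
  have hKv : (K : ℝ) = Nq q X / √n := rfl
  have h1 : ∀ x y, F x - F y ≤ K * √(∑ i, (x i - y i) ^ 2) := by
    intro x y
    have := lq_add hq (fun j => (1 / (n : ℝ)) * ∑ i, X i j * y i)
      (fun j => (1 / (n : ℝ)) * ∑ i, X i j * (x i - y i))
    have e : (fun j => (1 / (n : ℝ)) * ∑ i, X i j * y i + (1 / (n : ℝ)) * ∑ i, X i j * (x i - y i))
        = fun j => (1 / (n : ℝ)) * ∑ i, X i j * x i := by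
      ext j
      rw [← mul_add, ← Finset.sum_add_distrib]
      congr 1
      exact Finset.sum_congr rfl fun i _ => by ring
    rw [e] at this
    have h2 := lq_lin q hn X (fun i => x i - y i)
    rw [hKv]
    simp only [hFdef]
    linarith
  have hL : ∀ x y, |F x - F y| ≤ K * √(∑ i, (x i - y i) ^ 2) := by
    intro x y
    refine abs_sub_le_iff.2 ⟨h1 x y, (h1 y x).trans_eq ?_⟩
    congr 2
    exact Finset.sum_congr rfl fun i _ => by ring
  have hcont : Continuous F := by
    refine (LipschitzWith.of_dist_le_mul (K := K * n) fun x y => ?_).continuous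
    rw [Real.dist_eq]
    refine (hL x y).trans ?_
    push_cast
    rw [mul_assoc]
    gcongr
    refine (sqrt_sum_le fun i => x i - y i).trans ?_
    calc _ ≤ ∑ i : Fin n, dist x y := Finset.sum_le_sum fun i _ => by
            rw [← Real.dist_eq]; exact dist_le_pi_dist x y i
      _ = _ := by simp
  have hF0 : ∀ w, 0 ≤ F w := fun w => lq_nonneg _ _
  have hI : Integrable F P := by
    have hco : ∀ i, Integrable (fun w : Fin n → ℝ => |w i|) P := by
      intro i
      have := (memLp_id_gaussianReal (μ := 0) (v := v) 1).integrable le_rfl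
      have h3 := (measurePreserving_eval (fun _ : Fin n => gaussianReal 0 v) i).integrable_comp_of_integrable this
      exact h3.abs
    have hs : Integrable (fun w : Fin n → ℝ => K * ∑ i, |w i|) P :=
      (integrable_finsetSum _ fun i _ => hco i).const_mul _
    refine hs.mono' hcont.aestronglyMeasurable (.of_forall fun w => ?_)
    rw [Real.norm_of_nonneg (hF0 w)]
    refine (lq_lin q hn X w).trans ?_
    rw [← hKv]
    gcongr
    exact sqrt_sum_le w
  have hm0 : 0 ≤ ∫ w, F w ∂P := integral_nonneg hF0
  set r := σ * Nq q X * √(2 / (n : ℝ) * Real.log (1 / α)) with hr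
  have hr0 : 0 ≤ r := by positivity
  have hlog : 0 < Real.log (1 / α) := Real.log_pos (by rw [lt_div_iff₀ hα.1]; linarith [hα.2])
  rcases hN.eq_or_lt with hN0 | hN0
  · have : {w | F w ≤ (∫ w', F w' ∂P) + r} = Set.univ := by
      ext w
      simp only [Set.mem_ofPred_eq, Set.mem_univ, iff_true]
      have := lq_lin q hn X w
      rw [← hN0] at this
      simp only [zero_div, zero_mul] at this
      exact this.trans (add_nonneg hm0 hr0)
    rw [this, probReal_univ]
    linarith [hα.1]
  have tail := conc_tail hv hcont.measurable hI hL hr0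
  have ev : Real.exp (-r ^ 2 / (2 * (v * K ^ 2))) = α := by
    have : -r ^ 2 / (2 * (v * K ^ 2)) = - Real.log (1 / α) := by
      rw [hr, hvσ, hKv, mul_pow, Real.sq_sqrt (by positivity), div_pow, Real.sq_sqrt hn'.le]
      field_simp
    rw [this, one_div, Real.log_inv, neg_neg, Real.exp_log hα.1]
  rw [ev] at tail
  have hms : MeasurableSet {w | F w ≤ (∫ w', F w' ∂P) + r} :=
    measurableSet_le hcont.measurable measurable_const
  have hcompl := probReal_compl_eq_one_sub (μ := P) hms
  have : P.real {w | F w ≤ (∫ w', F w' ∂P) + r}ᶜ ≤ α := by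
    refine le_trans (measureReal_mono ?_) tail
    intro w hw
    simp only [Set.mem_compl_iff, Set.mem_ofPred_eq, not_le] at hw ⊢
    linarith
  linarith

end Helpers

/-- Proposition A.2.1. -/
theorem ideal_confidence_region_alternative
    (n L k p m : ℕ) (hn : 1 ≤ n) (hL : 1 ≤ L) (hk : 1 ≤ k) (hp : 1 ≤ p) (hm : 1 ≤ m)
    (X : Fin n → Fin L → ℝ) (g : (Fin k → ℝ) → (Fin p → ℝ) → ℝ)
    (V : Fin n → Fin k → ℝ) (θs : Fin p → ℝ) (σ : ℝ) (hσ : 0 < σ)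
    (h : (Fin p → ℝ) → Fin m → ℝ) (Ω : Set (Fin m → ℝ))
    (hΩne : Ω.Nonempty) (hΩcl : IsClosed Ω)
    (hΘ0 : {θ : Fin p → ℝ | h θ ∈ Ω}.Nonempty)
    (q qt : ℝ≥0∞) (hq : 1 ≤ q) (hqt : 1 ≤ qt)
    (α : ℝ) (hα : α ∈ Set.Ioo (0 : ℝ) 1) :
    (gaussianVec n σ {w : Fin n → ℝ |
        ∀ (θh : Fin p → ℝ) (μh : Fin L → ℝ),
          OptimalP1 X g V (fun i => g (V i) θs + w i) h Ω q qt
              ((∫ w', lqNorm q (fun j => (1 / (n : ℝ)) * ∑ i, X i j * w' i)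
                  ∂(gaussianVec n σ)) +
                σ * Nq q X * Real.sqrt ((2 / (n : ℝ)) * Real.log (1 / α))) θh μh →
            lqNorm qt (fun j =>
                (1 / (n : ℝ)) * ∑ i, X i j * (g (V i) θs - g (V i) θh))
              ≥ lqNorm qt μh ∧
            lqNorm q (fun j =>
                (1 / (n : ℝ)) * ∑ i, X i j * (g (V i) θs - g (V i) θh) - μh j)
              ≤ 2 * ((∫ w', lqNorm q (fun j => (1 / (n : ℝ)) * ∑ i, X i j * w' i)
                  ∂(gaussianVec n σ)) +
                σ * Nq q X * Real.sqrt ((2 / (n : ℝ)) * Real.log (1 / α)))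
        }).toReal ≥ 1 - α := by
  have : IsProbabilityMeasure (gaussianVec n σ) := pi_prob n _
  refine (tail_event hn X hσ hq hα).le.trans ?_
  refine measureReal_mono ?_
  intro w hw
  simp only [Set.mem_ofPred_eq] at hw ⊢
  intro θh μh hopt
  generalize (∫ w', lqNorm q (fun j => (1 / (n : ℝ)) * ∑ i, X i j * w' i) ∂(gaussianVec n σ)) +
    σ * Nq q X * Real.sqrt ((2 / (n : ℝ)) * Real.log (1 / α)) = r at *
  obtain ⟨⟨hf, hh⟩, hmin⟩ := hopt
  have split : ∀ j, (1 / (n : ℝ)) * ∑ i, X i j * (g (V i) θs + w i - g (V i) θh) =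
      (1 / (n : ℝ)) * ∑ i, X i j * (g (V i) θs - g (V i) θh) + (1 / (n : ℝ)) * ∑ i, X i j * w i := by
    intro j
    rw [← mul_add, ← Finset.sum_add_distrib]
    congr 1
    exact Finset.sum_congr rfl fun i _ => by ring
  constructor
  · refine hmin θh _ ⟨?_, hh⟩
    simp only [split, add_sub_cancel_left]
    exact hw
  · have h1 := lq_add hq
      (fun j => (1 / (n : ℝ)) * ∑ i, X i j * (g (V i) θs + w i - g (V i) θh) - μh j)
      (fun j => -((1 / (n : ℝ)) * ∑ i, X i j * w i))
    rw [lq_neg] at h1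
    have e : (fun j => (1 / (n : ℝ)) * ∑ i, X i j * (g (V i) θs + w i - g (V i) θh) - μh j +
        -((1 / (n : ℝ)) * ∑ i, X i j * w i)) = fun j =>
        (1 / (n : ℝ)) * ∑ i, X i j * (g (V i) θs - g (V i) θh) - μh j := by
      ext j
      rw [split]; ring
    rw [e] at h1
    linarith
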